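/- Let q ≥ 1 and let f : ℝ^q → ℝ^q be a smooth (C^∞) map with f(0) = 0 such that the n-fold iterate f ∘ ⋯ ∘ f equals the identity of ℝ^q for some n ≥ 1 (so f is a diffeomorphism of finite order). If the Fréchet derivative of f at 0 is the identity linear map of ℝ^q, then f coincides with the identity map on some neighborhood of 0. -/

import Mathlib

open Filter Topology in
/-- **Bochner linearization**: a map of finite order that is strictly differentiable at a fixed
point `a`, with derivative the identity, is the identity near `a`. The orbit sum
`x ↦ ∑ i < n, f^[i] x` is `f`-invariant and locally injective at `a`. -/
theorem HasStrictFDerivAt.eventually_eq_self_of_iterate_eq_id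
    {E : Type*} [NormedAddCommGroup E] [NormedSpace ℝ E] [CompleteSpace E]
    {f : E → E} {a : E} {n : ℕ} (hf : HasStrictFDerivAt f (ContinuousLinearMap.id ℝ E) a)
    (ha : f a = a) (hn : n ≠ 0) (hfn : f^[n] = id) :
    ∀ᶠ x in 𝓝 a, f x = x := by
  set φ : E → E := fun x ↦ ∑ i ∈ Finset.range n, f^[i] x with hφ
  have invariant (x : E) : φ (f x) = φ x := by
    have h := (Finset.sum_range_succ' (fun i ↦ f^[i] x) n).symm.trans
      (Finset.sum_range_succ (fun i ↦ f^[i] x) n)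
    simpa [hφ, hfn] using h
  let e : E ≃L[ℝ] E := ContinuousLinearEquiv.smulLeft (Units.mk0 (n : ℝ) (by exact_mod_cast hn))
  have deriv_φ : HasStrictFDerivAt φ (e : E →L[ℝ] E) a := by
    have h : HasStrictFDerivAt φ
        (∑ i ∈ Finset.range n, ContinuousLinearMap.id ℝ E ^ i) a :=
      HasStrictFDerivAt.fun_sum fun i _ ↦ hf.iterate ha i
    convert h using 1
    ext x
    simp [e, ← ContinuousLinearMap.one_def, Units.smul_def, Nat.cast_smul_eq_nsmul]
  have left_inv := deriv_φ.eventually_left_inverse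
  have tendsto_f : Tendsto f (𝓝 a) (𝓝 a) := by
    simpa only [ha] using hf.continuousAt.tendsto
  filter_upwards [left_inv, tendsto_f.eventually left_inv] with x hx hfx
  rw [← hfx, invariant, hx]


/-- Let `q ≥ 1` and let `f : ℝ^q → ℝ^q` be a smooth map with `f 0 = 0`
whose `n`-fold iterate is the identity for some `n ≥ 1` (so `f` is a diffeomorphism of
finite order).  If the Fréchet derivative of `f` at `0` is the identity linear map of
`ℝ^q`, then `f` coincides with the identity on a neighborhood of `0`. -/
theorem finite_order_diffeo_with_identity_derivative_is_locally_identity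
    (q : ℕ) (hq : 1 ≤ q)
    (f : EuclideanSpace ℝ (Fin q) → EuclideanSpace ℝ (Fin q))
    (hf : ContDiff ℝ ((⊤ : ℕ∞) : WithTop ℕ∞) f) (hf0 : f 0 = 0)
    (n : ℕ) (hn : 1 ≤ n) (hfn : f^[n] = id)
    (hD : fderiv ℝ f 0 = ContinuousLinearMap.id ℝ (EuclideanSpace ℝ (Fin q))) :
    ∃ U ∈ nhds (0 : EuclideanSpace ℝ (Fin q)), ∀ x ∈ U, f x = x := by
  have hf' : HasStrictFDerivAt f
      (ContinuousLinearMap.id ℝ (EuclideanSpace ℝ (Fin q))) 0 :=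
    hD ▸ hf.contDiffAt.hasStrictFDerivAt (by simp)
  exact ⟨_, hf'.eventually_eq_self_of_iterate_eq_id hf0 (by omega) hfn, fun _ hx ↦ hx⟩
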